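/- arXiv:2104.07781 — 3 statements merged into one kernel-verified Lean document; each statement's English description precedes it below -/
import Mathlib

section
/- Suppose x : ℝ → ℝ^N is differentiable and satisfies the consensus dynamics x'(t) = −(Lᴵ + Lᴱ) x(t) for all t. Define the slow variable y(t) = P⁻¹Uᵀx(t) ∈ ℝ^r, the fast variable e_x(t) = W x(t) ∈ ℝ^N, and the inter-area variable e_y(t) = W_r y(t) ∈ ℝ^r, and the composite Lyapunov function V(t) = ½‖e_y(t)‖² + (ε/2)‖e_x(t)‖². Assume: (i) there is a constant cE > 0 with vᵀLᴱv ≤ cE‖v‖² for all v ∈ ℝ^N (spectral-norm bound on Lᴱ); (ii) there is sE > 0 such that vᵀLᴱv ≥ sE‖v‖² for every v ∈ ℝ^N with 1_Nᵀv = 0, and also (Uw)ᵀLᴱ(Uw) ≥ sE‖Uw‖² for every w ∈ ℝ^r with 1_rᵀw = 0; (iii) there is sI > 0 such that vᵀLᴵv ≥ sI‖v‖² for every v ∈ ℝ^N with Uᵀv = 0 (spectral gap of each cluster); (iv) P commutes with UᵀLᴱU; (v) the cluster-strength condition sI ≥ 2 cE² N_max² / (sE N_min²) holds; and set ε = N_min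 sE / (2 N_max² cE). Then for all t ≥ 0, V(t) ≤ exp(−(N_min sE/(2 N_max)) t) · V(0). -/
open Matrix

noncomputable section

/-- The node set of a network of `r` clusters with sizes `Nv α`. -/
abbrev ClusterNode (r : ℕ) (Nv : Fin r → ℕ) := (α : Fin r) × Fin (Nv α)

/-- `U = diag(1_{N_1},…,1_{N_r}) ∈ ℝ^{N×r}`, the block-diagonal matrix whose
`α`-th column block is the all-ones vector `1_{N_α}`. -/
def clusterU (r : ℕ) (Nv : Fin r → ℕ) : Matrix (ClusterNode r Nv) (Fin r) ℝ :=
  Matrix.of fun v β => if v.1 = β then (1 : ℝ) else 0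

/-- `P = diag(N_1,…,N_r) ∈ ℝ^{r×r}`. -/
def clusterP (r : ℕ) (Nv : Fin r → ℕ) : Matrix (Fin r) (Fin r) ℝ :=
  Matrix.diagonal fun α => (Nv α : ℝ)

/-- `P⁻¹ = diag(1/N_1,…,1/N_r) ∈ ℝ^{r×r}`. -/
def clusterPinv (r : ℕ) (Nv : Fin r → ℕ) : Matrix (Fin r) (Fin r) ℝ :=
  Matrix.diagonal fun α => ((Nv α : ℝ))⁻¹

/-- The centering matrix `W_n = I_n − (1/n) 1_n 1_nᵀ`. -/
def centering (n : ℕ) : Matrix (Fin n) (Fin n) ℝ :=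
  (1 : Matrix (Fin n) (Fin n) ℝ) - ((n : ℝ)⁻¹) • Matrix.of fun _ _ => (1 : ℝ)

/-- `W = diag(W_1,…,W_r)` the block-diagonal centering matrix. -/
def clusterW (r : ℕ) (Nv : Fin r → ℕ) : Matrix (ClusterNode r Nv) (ClusterNode r Nv) ℝ :=
  Matrix.blockDiagonal' fun α => centering (Nv α)

/-- The slow variable `y = P⁻¹ Uᵀ x`. -/
def slowVar (r : ℕ) (Nv : Fin r → ℕ) (x : ClusterNode r Nv → ℝ) : Fin r → ℝ :=
  clusterPinv r Nv *ᵥ ((clusterU r Nv)ᵀ *ᵥ x)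

/-- The fast variable `e_x = W x`. -/
def fastVar (r : ℕ) (Nv : Fin r → ℕ) (x : ClusterNode r Nv → ℝ) : ClusterNode r Nv → ℝ :=
  clusterW r Nv *ᵥ x

/-- The inter-area variable `e_y = W_r y`. -/
def interArea (r : ℕ) (Nv : Fin r → ℕ) (x : ClusterNode r Nv → ℝ) : Fin r → ℝ :=
  centering r *ᵥ slowVar r Nv x

section MatrixLemmas

variable {m n : Type*} [Fintype m] [Fintype n]

theorem blockDiagonal'_mulVec_apply {o : Type*} [Fintype o] [DecidableEq o] {k : o → Type*}
    [∀ i, Fintype (k i)] (M : ∀ i, Matrix (k i) (k i) ℝ) (v : (Σ i, k i) → ℝ) (a : o) (i : k a) :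
    (blockDiagonal' M *ᵥ v) ⟨a, i⟩ = (M a *ᵥ fun j => v ⟨a, j⟩) i := by
  simp only [mulVec, dotProduct]
  rw [Fintype.sum_sigma, Finset.sum_eq_single a]
  · simp
  · intro b _ hb
    exact Finset.sum_eq_zero fun j _ => by rw [blockDiagonal'_apply_ne _ _ _ hb.symm, zero_mul]
  · simp

theorem dotProduct_mulVec_comm_of_isHermitian {A : Matrix n n ℝ} (hA : A.IsHermitian)
    (u v : n → ℝ) : u ⬝ᵥ (A *ᵥ v) = v ⬝ᵥ (A *ᵥ u) := by
  rw [dotProduct_mulVec, ← mulVec_transpose, ← conjTranspose_eq_transpose_of_trivial, hA.eq,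
    dotProduct_comm]

theorem HasDerivAt.mulVec_dotProduct_self (K : Matrix m n ℝ) {x : ℝ → n → ℝ} {x' : n → ℝ}
    {t : ℝ} (hx : HasDerivAt x x' t) :
    HasDerivAt (fun s => (K *ᵥ x s) ⬝ᵥ (K *ᵥ x s)) (2 * ((K *ᵥ x t) ⬝ᵥ (K *ᵥ x'))) t := by
  have hK : ∀ i, HasDerivAt (fun s => (K *ᵥ x s) i) ((K *ᵥ x') i) t := fun i =>
    HasDerivAt.fun_sum fun j _ => (hasDerivAt_pi.1 hx j).const_mul (K i j)
  have h := HasDerivAt.fun_sum (u := Finset.univ) fun i _ => (hK i).mul (hK i)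
  refine h.congr_deriv ?_
  simp only [dotProduct, Finset.mul_sum]
  exact Finset.sum_congr rfl fun i _ => by ring

end MatrixLemmas

theorem le_exp_mul_of_hasDerivAt_le {V V' : ℝ → ℝ} {k : ℝ} (hV : ∀ t, HasDerivAt V (V' t) t)
    (hle : ∀ t, V' t ≤ -k * V t) {t : ℝ} (ht : 0 ≤ t) : V t ≤ Real.exp (-k * t) * V 0 := by
  have hd : ∀ s, HasDerivAt (fun s => Real.exp (k * s) * V s)
      (Real.exp (k * s) * (k * 1) * V s + Real.exp (k * s) * V' s) s := fun s =>
    (((hasDerivAt_id s).const_mul k).exp).mul (hV s)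
  have hanti : Antitone fun s => Real.exp (k * s) * V s := by
    refine antitone_of_deriv_nonpos (fun s => (hd s).differentiableAt) fun s => ?_
    rw [(hd s).deriv]
    nlinarith [hle s, Real.exp_pos (k * s)]
  have h := hanti ht
  simp only [mul_zero, Real.exp_zero, one_mul] at h
  calc V t = Real.exp (-k * t) * (Real.exp (k * t) * V t) := by
        rw [← mul_assoc, ← Real.exp_add]; simp
    _ ≤ _ := by gcongr

section Cluster

variable {r : ℕ} {Nv : Fin r → ℕ}

theorem centering_mulVec_apply {n : ℕ} (v : Fin n → ℝ) (i : Fin n) :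
    (centering n *ᵥ v) i = v i - (n : ℝ)⁻¹ * ∑ j, v j := by
  rw [centering, sub_mulVec, one_mulVec, smul_mulVec]
  simp [mulVec, dotProduct]

theorem sum_centering_mulVec {n : ℕ} (v : Fin n → ℝ) : ∑ i, (centering n *ᵥ v) i = 0 := by
  rcases Nat.eq_zero_or_pos n with rfl | hn
  · simp
  · have : (n : ℝ) ≠ 0 := by positivity
    simp [centering_mulVec_apply, this]

theorem clusterU_mulVec_apply (w : Fin r → ℝ) (v : ClusterNode r Nv) :
    (clusterU r Nv *ᵥ w) v = w v.1 := by
  simp [clusterU, mulVec, dotProduct]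

theorem clusterU_transpose_mulVec_apply (x : ClusterNode r Nv → ℝ) (α : Fin r) :
    ((clusterU r Nv)ᵀ *ᵥ x) α = ∑ i, x ⟨α, i⟩ := by
  simp only [clusterU, mulVec, dotProduct, transpose_apply, of_apply, ite_mul, one_mul, zero_mul]
  rw [Fintype.sum_sigma, Finset.sum_eq_single α]
  · simp
  · intro β _ hβ
    simp [hβ]
  · simp

theorem clusterU_mulVec_dotProduct (w : Fin r → ℝ) (x : ClusterNode r Nv → ℝ) :
    (clusterU r Nv *ᵥ w) ⬝ᵥ x = w ⬝ᵥ ((clusterU r Nv)ᵀ *ᵥ x) := by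
  rw [mulVec_transpose, dotProduct_comm w, ← dotProduct_mulVec, dotProduct_comm]

theorem clusterU_mulVec_dotProduct_self (w : Fin r → ℝ) :
    (clusterU r Nv *ᵥ w) ⬝ᵥ (clusterU r Nv *ᵥ w) = ∑ α, (Nv α : ℝ) * w α ^ 2 := by
  rw [clusterU_mulVec_dotProduct, dotProduct]
  refine Finset.sum_congr rfl fun α _ => ?_
  simp only [clusterU_transpose_mulVec_apply, clusterU_mulVec_apply, Finset.sum_const,
    Finset.card_univ, Fintype.card_fin, nsmul_eq_mul]
  ring

theorem clusterU_mulVec_one :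
    clusterU r Nv *ᵥ (fun _ => (1 : ℝ)) = fun _ => 1 := by
  ext v
  rw [clusterU_mulVec_apply]

theorem slowVar_apply (x : ClusterNode r Nv → ℝ) (α : Fin r) :
    slowVar r Nv x α = (Nv α : ℝ)⁻¹ * ∑ i, x ⟨α, i⟩ := by
  rw [slowVar, clusterPinv, mulVec_diagonal, clusterU_transpose_mulVec_apply]

theorem fastVar_eq (x : ClusterNode r Nv → ℝ) :
    fastVar r Nv x = x - clusterU r Nv *ᵥ slowVar r Nv x := by
  ext ⟨α, i⟩
  rw [fastVar, clusterW, blockDiagonal'_mulVec_apply, centering_mulVec_apply, Pi.sub_apply,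
    clusterU_mulVec_apply, slowVar_apply]

theorem clusterU_transpose_mulVec_fastVar (x : ClusterNode r Nv → ℝ) :
    (clusterU r Nv)ᵀ *ᵥ fastVar r Nv x = 0 := by
  ext α
  rw [clusterU_transpose_mulVec_apply, Pi.zero_apply,
    ← sum_centering_mulVec fun i => x ⟨α, i⟩]
  exact Finset.sum_congr rfl fun i _ => by
    rw [fastVar, clusterW, blockDiagonal'_mulVec_apply]

theorem sum_fastVar (x : ClusterNode r Nv → ℝ) : ∑ v, fastVar r Nv x v = 0 := by
  rw [Fintype.sum_sigma]
  exact Finset.sum_eq_zero fun α _ => by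
    rw [← clusterU_transpose_mulVec_apply, clusterU_transpose_mulVec_fastVar, Pi.zero_apply]

theorem sum_interArea (x : ClusterNode r Nv → ℝ) : ∑ α, interArea r Nv x α = 0 :=
  sum_centering_mulVec _

theorem slowVar_eq_interArea_add (x : ClusterNode r Nv → ℝ) :
    slowVar r Nv x =
      interArea r Nv x + ((r : ℝ)⁻¹ * ∑ α, slowVar r Nv x α) • fun _ => (1 : ℝ) := by
  ext α
  simp [interArea, centering_mulVec_apply]

theorem eq_fastVar_add_interArea (x : ClusterNode r Nv → ℝ) :
    x = fastVar r Nv x + clusterU r Nv *ᵥ interArea r Nv x +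
      ((r : ℝ)⁻¹ * ∑ α, slowVar r Nv x α) • fun _ => (1 : ℝ) := by
  have h := congrArg (clusterU r Nv *ᵥ ·) (slowVar_eq_interArea_add x)
  simp only [mulVec_add, mulVec_smul, clusterU_mulVec_one] at h
  rw [fastVar_eq, h]
  abel

theorem fastVar_dotProduct_clusterU_mulVec (x : ClusterNode r Nv → ℝ) (w : Fin r → ℝ) :
    fastVar r Nv x ⬝ᵥ (clusterU r Nv *ᵥ w) = 0 := by
  rw [dotProduct_comm, clusterU_mulVec_dotProduct, clusterU_transpose_mulVec_fastVar,
    dotProduct_zero]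

theorem fastVar_dotProduct_fastVar (x f : ClusterNode r Nv → ℝ) :
    fastVar r Nv x ⬝ᵥ fastVar r Nv f = fastVar r Nv x ⬝ᵥ f := by
  rw [fastVar_eq f, dotProduct_sub, fastVar_dotProduct_clusterU_mulVec, sub_zero]

theorem interArea_dotProduct_interArea (x f : ClusterNode r Nv → ℝ) :
    interArea r Nv x ⬝ᵥ interArea r Nv f = interArea r Nv x ⬝ᵥ slowVar r Nv f := by
  have h : interArea r Nv x ⬝ᵥ (fun _ => (1 : ℝ)) = 0 := by
    simpa [dotProduct] using sum_interArea x
  conv_rhs => rw [slowVar_eq_interArea_add f, dotProduct_add, dotProduct_smul, h, smul_zero,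
    add_zero]

theorem blockDiagonal'_mulVec_clusterU (Lb : ∀ α : Fin r, Matrix (Fin (Nv α)) (Fin (Nv α)) ℝ)
    (hLb1 : ∀ α, Lb α *ᵥ (fun _ => (1 : ℝ)) = 0) (w : Fin r → ℝ) :
    blockDiagonal' Lb *ᵥ (clusterU r Nv *ᵥ w) = 0 := by
  ext ⟨α, i⟩
  have h : (fun j : Fin (Nv α) => (clusterU r Nv *ᵥ w) ⟨α, j⟩) = w α • fun _ => (1 : ℝ) := by
    ext j
    simp [clusterU_mulVec_apply]
  rw [blockDiagonal'_mulVec_apply, h, mulVec_smul, hLb1, smul_zero, Pi.zero_apply, Pi.zero_apply]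

/-- If `P` commutes with `UᵀLᴱU`, then `P 1` lies in the kernel of `UᵀLᴱU`, and the spectral gap
of `Lᴱ` on the range of `U` forces it to be a multiple of `1`. -/
theorem cluster_sizes_eq (hNv : ∀ α, 0 < Nv α)
    {LE : Matrix (ClusterNode r Nv) (ClusterNode r Nv) ℝ}
    (hLE1 : LE *ᵥ (fun _ => (1 : ℝ)) = 0) {sE : ℝ} (hsE : 0 < sE)
    (hsEgapU : ∀ w : Fin r → ℝ, (∑ α, w α) = 0 →
      sE * ((clusterU r Nv *ᵥ w) ⬝ᵥ (clusterU r Nv *ᵥ w)) ≤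
        (clusterU r Nv *ᵥ w) ⬝ᵥ (LE *ᵥ (clusterU r Nv *ᵥ w)))
    (hcomm : clusterP r Nv * ((clusterU r Nv)ᵀ * LE * clusterU r Nv) =
      ((clusterU r Nv)ᵀ * LE * clusterU r Nv) * clusterP r Nv) (α β : Fin r) :
    Nv α = Nv β := by
  set M := (clusterU r Nv)ᵀ * LE * clusterU r Nv with hM
  set p : Fin r → ℝ := fun α => Nv α with hp
  set w := centering r *ᵥ p with hw
  have hM1 : M *ᵥ (fun _ => (1 : ℝ)) = 0 := by
    rw [hM, ← mulVec_mulVec, clusterU_mulVec_one, ← mulVec_mulVec, hLE1, mulVec_zero]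
  have hP1 : clusterP r Nv *ᵥ (fun _ => (1 : ℝ)) = p := by
    ext α
    simp [clusterP, mulVec_diagonal, hp]
  have hMp : M *ᵥ p = 0 := by
    rw [← hP1, mulVec_mulVec, ← hcomm, ← mulVec_mulVec, hM1, mulVec_zero]
  have hwp : w = p - ((r : ℝ)⁻¹ * ∑ α, p α) • fun _ => (1 : ℝ) := by
    ext α
    simp [hw, centering_mulVec_apply]
  have hMw : M *ᵥ w = 0 := by
    rw [hwp, mulVec_sub, mulVec_smul, hMp, hM1, smul_zero, sub_zero]
  have hgap := hsEgapU w (sum_centering_mulVec p)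
  rw [clusterU_mulVec_dotProduct w (LE *ᵥ _), mulVec_mulVec w, mulVec_mulVec w,
    ← Matrix.mul_assoc, ← hM, hMw, dotProduct_zero, clusterU_mulVec_dotProduct_self] at hgap
  have hterm : ∀ γ ∈ Finset.univ, 0 ≤ (Nv γ : ℝ) * w γ ^ 2 := fun γ _ => by positivity
  have hsum : ∑ γ, (Nv γ : ℝ) * w γ ^ 2 = 0 :=
    le_antisymm (by_contra fun h => by nlinarith [mul_pos hsE (not_le.1 h)])
      (Finset.sum_nonneg hterm)
  have hw0 : ∀ γ, w γ = 0 := fun γ => by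
    have h := (Finset.sum_eq_zero_iff_of_nonneg hterm).1 hsum γ (Finset.mem_univ γ)
    have hγ : (Nv γ : ℝ) ≠ 0 := by exact_mod_cast (hNv γ).ne'
    simpa [hγ] using h
  have hα := hw0 α
  have hβ := hw0 β
  rw [hw, centering_mulVec_apply] at hα hβ
  have : (Nv α : ℝ) = Nv β := by simp only [hp] at hα hβ; linarith
  exact_mod_cast this

end Cluster

/-- The scalar dissipation estimate: `X, Y` are the squared norms of the fast and inter-area
variables, and `A, B, C` the values of the external quadratic form on them. -/
theorem dissipation_le {n cE sE sI ε A B C I X Y : ℝ} (hn : 0 < n) (hcE : 0 < cE) (hsE : 0 < sE)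
    (hε : ε = sE / (2 * n * cE)) (hsI : 2 * cE ^ 2 / sE ≤ sI)
    (hX : 0 ≤ X) (hY : 0 ≤ Y) (hABC : 0 ≤ A + B + 2 * C)
    (hA : sE * X ≤ A) (hA' : A ≤ cE * X) (hB : sE * (n * Y) ≤ B) (hB' : B ≤ cE * (n * Y))
    (hI : sI * X ≤ I) :
    -(n⁻¹ * (B + C)) - ε * (I + A + C) ≤ -(sE / 2) * (1 / 2 * Y + ε / 2 * X) := by
  have hε0 : 0 < ε := by rw [hε]; positivity
  have hIA : n⁻¹ * A ≤ ε * I := by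
    have h1 : ε * (2 * cE ^ 2 / sE) = n⁻¹ * cE := by
      rw [hε]
      field_simp
    calc n⁻¹ * A ≤ n⁻¹ * (cE * X) := by gcongr
      _ = ε * (2 * cE ^ 2 / sE * X) := by rw [← mul_assoc, ← h1]; ring
      _ ≤ ε * (sI * X) := by gcongr
      _ ≤ ε * I := by gcongr
  have hBY : sE * Y ≤ n⁻¹ * B := by
    rw [inv_mul_eq_div, le_div_iff₀ hn]
    linarith
  have hAX : ε * (sE * X) ≤ ε * A := by gcongr
  have hA0 : 0 ≤ A := le_trans (by positivity) hA
  have hB0 : 0 ≤ B := le_trans (by positivity) hB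
  have hn' : 0 < n⁻¹ := inv_pos.2 hn
  have hnABC := mul_nonneg hn'.le hABC
  have hεABC := mul_nonneg hε0.le hABC
  have hnA := mul_nonneg hn'.le hA0
  have hnB := mul_nonneg hn'.le hB0
  have hεA := mul_nonneg hε0.le hA0
  have hεB : ε * B ≤ n⁻¹ / 2 * B := by
    rcases le_or_gt sE cE with h | h
    · gcongr
      rw [hε, inv_eq_one_div, div_div, div_le_div_iff₀ (by positivity) (by positivity)]
      nlinarith
    · have hnY : n * Y = 0 := by nlinarith [mul_nonneg hn.le hY]
      have : B = 0 := by rw [hnY, mul_zero] at hB'; linarith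
      simp [this]
  linarith

/-- Theorem 1 (convergence rate of distributed consensus over cluster networks):
under the spectral assumptions (i)–(v) and the choice of `ε`, the composite
Lyapunov function `V = ½‖e_y‖² + (ε/2)‖e_x‖²` decays exponentially with rate
`N_min sE / (2 N_max)` along the consensus dynamics `x' = −(Lᴵ + Lᴱ) x`. -/
theorem consensus_cluster_convergence_rate
    (r : ℕ) (Nv : Fin r → ℕ) (hNv : ∀ α, 0 < Nv α)
    -- internal Laplacian: block diagonal of symmetric PSD blocks annihilating ones
    (Lb : ∀ α : Fin r, Matrix (Fin (Nv α)) (Fin (Nv α)) ℝ)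
    (hLb : ∀ α, (Lb α).PosSemidef)
    (hLb1 : ∀ α, Lb α *ᵥ (fun _ => (1 : ℝ)) = 0)
    -- external Laplacian: symmetric PSD with ones in its kernel
    (LE : Matrix (ClusterNode r Nv) (ClusterNode r Nv) ℝ)
    (hLE : LE.PosSemidef)
    (hLE1 : LE *ᵥ (fun _ => (1 : ℝ)) = 0)
    -- minimal and maximal cluster sizes
    (Nmin Nmax : ℕ)
    (hNmin : IsLeast (Set.range Nv) Nmin)
    (hNmax : IsGreatest (Set.range Nv) Nmax)
    -- consensus dynamics x' = −(Lᴵ + Lᴱ) x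
    (x : ℝ → ClusterNode r Nv → ℝ)
    (hx : ∀ t : ℝ, HasDerivAt x (-((Matrix.blockDiagonal' Lb + LE) *ᵥ x t)) t)
    -- (i) spectral-norm bound on Lᴱ
    (cE : ℝ) (hcE : 0 < cE)
    (hcEbound : ∀ v : ClusterNode r Nv → ℝ, v ⬝ᵥ (LE *ᵥ v) ≤ cE * (v ⬝ᵥ v))
    -- (ii) spectral gap of Lᴱ on mean-zero vectors and on U-images of mean-zero vectors
    (sE : ℝ) (hsE : 0 < sE)
    (hsEgap : ∀ v : ClusterNode r Nv → ℝ, (∑ i, v i) = 0 →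
      sE * (v ⬝ᵥ v) ≤ v ⬝ᵥ (LE *ᵥ v))
    (hsEgapU : ∀ w : Fin r → ℝ, (∑ α, w α) = 0 →
      sE * ((clusterU r Nv *ᵥ w) ⬝ᵥ (clusterU r Nv *ᵥ w)) ≤
        (clusterU r Nv *ᵥ w) ⬝ᵥ (LE *ᵥ (clusterU r Nv *ᵥ w)))
    -- (iii) spectral gap of the internal Laplacian on cluster-mean-zero vectors
    (sI : ℝ) (hsI : 0 < sI)
    (hsIgap : ∀ v : ClusterNode r Nv → ℝ, (clusterU r Nv)ᵀ *ᵥ v = 0 →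
      sI * (v ⬝ᵥ v) ≤ v ⬝ᵥ (Matrix.blockDiagonal' Lb *ᵥ v))
    -- (iv) P commutes with UᵀLᴱU
    (hcomm : clusterP r Nv * ((clusterU r Nv)ᵀ * LE * clusterU r Nv) =
      ((clusterU r Nv)ᵀ * LE * clusterU r Nv) * clusterP r Nv)
    -- (v) cluster-strength condition
    (hstrength : sI ≥ 2 * cE ^ 2 * (Nmax : ℝ) ^ 2 / (sE * (Nmin : ℝ) ^ 2))
    -- choice of the singular-perturbation parameter ε
    (ε : ℝ) (hε : ε = (Nmin : ℝ) * sE / (2 * (Nmax : ℝ) ^ 2 * cE)) :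
    ∀ t : ℝ, 0 ≤ t →
      (1 / 2) * (interArea r Nv (x t) ⬝ᵥ interArea r Nv (x t))
          + (ε / 2) * (fastVar r Nv (x t) ⬝ᵥ fastVar r Nv (x t))
        ≤ Real.exp (-((Nmin : ℝ) * sE / (2 * (Nmax : ℝ))) * t) *
            ((1 / 2) * (interArea r Nv (x 0) ⬝ᵥ interArea r Nv (x 0))
              + (ε / 2) * (fastVar r Nv (x 0) ⬝ᵥ fastVar r Nv (x 0))) := by
  obtain ⟨α₀, hα₀⟩ := hNmin.1
  have hsize : ∀ α, Nv α = Nmin := fun α => by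
    rw [← hα₀]
    exact cluster_sizes_eq hNv hLE1 hsE hsEgapU hcomm α α₀
  have hmax : Nmax = Nmin := by
    obtain ⟨β, hβ⟩ := hNmax.1
    rw [← hβ, hsize]
  have hn : (0 : ℝ) < Nmin := by
    rw [← hα₀]
    exact_mod_cast hNv α₀
  subst hmax
  have hrate : (Nmax : ℝ) * sE / (2 * Nmax) = sE / 2 := by field_simp
  have hε' : ε = sE / (2 * Nmax * cE) := by
    rw [hε]
    field_simp
  have hsI' : 2 * cE ^ 2 / sE ≤ sI := by
    convert hstrength.le using 1
    field_simp
  have hLI : (blockDiagonal' Lb).IsHermitian := by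
    rw [IsHermitian, blockDiagonal'_conjTranspose]
    exact congrArg _ (funext fun α => (hLb α).1)
  have hslow : ∀ (w : Fin r → ℝ) f, w ⬝ᵥ slowVar r Nv f =
      (Nmax : ℝ)⁻¹ * ((clusterU r Nv *ᵥ w) ⬝ᵥ f) := fun w f => by
    rw [clusterU_mulVec_dotProduct, dotProduct, dotProduct, Finset.mul_sum]
    refine Finset.sum_congr rfl fun α _ => ?_
    rw [slowVar_apply, clusterU_transpose_mulVec_apply,
      show (Nv α : ℝ) = Nmax by rw [hsize]]
    ring
  have hV : ∀ t, HasDerivAt (fun t => (1 / 2) * (interArea r Nv (x t) ⬝ᵥ interArea r Nv (x t))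
      + (ε / 2) * (fastVar r Nv (x t) ⬝ᵥ fastVar r Nv (x t)))
      (interArea r Nv (x t) ⬝ᵥ interArea r Nv (-((blockDiagonal' Lb + LE) *ᵥ x t)) +
        ε * (fastVar r Nv (x t) ⬝ᵥ fastVar r Nv (-((blockDiagonal' Lb + LE) *ᵥ x t)))) t := by
    intro t
    have h1 := (hx t).mulVec_dotProduct_self
      (centering r * (clusterPinv r Nv * (clusterU r Nv)ᵀ))
    have h2 := (hx t).mulVec_dotProduct_self (clusterW r Nv)
    simp only [← mulVec_mulVec] at h1
    refine ((h1.const_mul (1 / 2)).add (h2.const_mul (ε / 2))).congr_deriv ?_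
    simp only [interArea, slowVar, fastVar]
    ring
  intro t ht
  rw [hrate]
  refine le_exp_mul_of_hasDerivAt_le hV (fun t => ?_) ht
  rw [interArea_dotProduct_interArea, fastVar_dotProduct_fastVar, hslow]
  set a := fastVar r Nv (x t) with ha
  set w := interArea r Nv (x t) with hw
  set b := clusterU r Nv *ᵥ w with hb
  have hone : blockDiagonal' Lb *ᵥ (fun _ => (1 : ℝ)) = 0 := by
    rw [← clusterU_mulVec_one]
    exact blockDiagonal'_mulVec_clusterU Lb hLb1 _
  have hbI : blockDiagonal' Lb *ᵥ b = 0 := blockDiagonal'_mulVec_clusterU Lb hLb1 w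
  have hL : (blockDiagonal' Lb + LE) *ᵥ x t = blockDiagonal' Lb *ᵥ a + LE *ᵥ (a + b) := by
    rw [eq_fastVar_add_interArea (x t), ← ha, ← hw, ← hb, mulVec_add _ (a + b), mulVec_smul,
      add_mulVec, add_mulVec, hone, hLE1, mulVec_add _ a b, hbI]
    simp
  have hbb : b ⬝ᵥ b = Nmax * (w ⬝ᵥ w) := by
    rw [hb, clusterU_mulVec_dotProduct_self, dotProduct, Finset.mul_sum]
    exact Finset.sum_congr rfl fun α _ => by rw [hsize]; ring
  have hba : b ⬝ᵥ (LE *ᵥ a) = a ⬝ᵥ (LE *ᵥ b) := dotProduct_mulVec_comm_of_isHermitian hLE.1 b a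
  have hpos : 0 ≤ a ⬝ᵥ (LE *ᵥ a) + b ⬝ᵥ (LE *ᵥ b) + 2 * (a ⬝ᵥ (LE *ᵥ b)) := by
    have h := hLE.dotProduct_mulVec_nonneg (a + b)
    rw [star_trivial, mulVec_add, add_dotProduct, dotProduct_add, dotProduct_add, hba] at h
    linarith
  have hB := hsEgapU w (sum_interArea _)
  have hB' := hcEbound b
  rw [← hb, hbb] at hB
  rw [hbb] at hB'
  have key := dissipation_le hn hcE hsE hε' hsI' (dotProduct_star_self_nonneg a)
    (dotProduct_star_self_nonneg w) hpos (hsEgap a (sum_fastVar _)) (hcEbound a) hB hB'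
    (hsIgap a (clusterU_transpose_mulVec_fastVar _))
  have hbIa : b ⬝ᵥ (blockDiagonal' Lb *ᵥ a) = 0 := by
    rw [dotProduct_mulVec_comm_of_isHermitian hLI, hbI, dotProduct_zero]
  rw [hL, dotProduct_neg, dotProduct_neg, mulVec_add, dotProduct_add, dotProduct_add,
    dotProduct_add, dotProduct_add, hbIa, hba]
  simp only [star_trivial] at key
  linarith
end
end

section
/- Suppose x : ℝ → ℝ^N is differentiable and satisfies x'(t) = −(Lᴵ + Lᴱ) x(t) for all t. Define y(t) = P⁻¹Uᵀx(t) and e_x(t) = W x(t). Then y is differentiable and its derivative satisfies y'(t) = −P⁻¹UᵀLᴱU y(t) − P⁻¹UᵀLᴱ e_x(t) for all t. -/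
open Matrix

noncomputable section

/-- Block-wise centering is the complement of averaging over clusters. -/
lemma clusterW_eq_one_sub (r : ℕ) (Nv : Fin r → ℕ) :
    clusterW r Nv = 1 - clusterU r Nv * (clusterPinv r Nv * (clusterU r Nv)ᵀ) := by
  ext ⟨α, i⟩ ⟨β, j⟩
  simp only [clusterW, clusterU, clusterPinv, centering, Matrix.sub_apply, Matrix.mul_apply,
    Matrix.transpose_apply, Matrix.of_apply, ite_mul, one_mul, zero_mul,
    Finset.sum_ite_eq, Finset.mem_univ, if_true]
  rcases eq_or_ne α β with rfl | h
  · simp [Matrix.blockDiagonal'_apply_eq, Matrix.one_apply]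
  · simp [Matrix.blockDiagonal'_apply_ne _ _ _ h, h]

/-- If every block has vanishing column sums, so does the block-diagonal matrix, cluster by
cluster. -/
lemma clusterU_transpose_mul_blockDiagonal' (r : ℕ) (Nv : Fin r → ℕ)
    (Lb : ∀ α : Fin r, Matrix (Fin (Nv α)) (Fin (Nv α)) ℝ)
    (h : ∀ α, (fun _ => (1 : ℝ)) ᵥ* Lb α = 0) :
    (clusterU r Nv)ᵀ * Matrix.blockDiagonal' Lb = 0 := by
  ext β ⟨α, j⟩
  simp only [clusterU, Matrix.mul_apply, Matrix.transpose_apply, Matrix.of_apply,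
    Matrix.zero_apply, Fintype.sum_sigma]
  refine Finset.sum_eq_zero fun γ _ => ?_
  rcases eq_or_ne γ α with rfl | hne
  · have hj := congrFun (h γ) j
    simp only [Matrix.vecMul, dotProduct, one_mul, Pi.zero_apply] at hj
    simp [Matrix.blockDiagonal'_apply_eq, hj]
  · simp [Matrix.blockDiagonal'_apply_ne _ _ _ hne]

/-- Lemma 1, equation (15): along the consensus dynamics `x' = −(Lᴵ + Lᴱ)x`,
the slow variable `y = P⁻¹Uᵀx` is differentiable with
`y' = −P⁻¹UᵀLᴱU y − P⁻¹UᵀLᴱ e_x`. -/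
theorem slowVar_dynamics
    (r : ℕ) (Nv : Fin r → ℕ) (hNv : ∀ α, 0 < Nv α)
    (Lb : ∀ α : Fin r, Matrix (Fin (Nv α)) (Fin (Nv α)) ℝ)
    (hLb : ∀ α, (Lb α).PosSemidef)
    (hLb1 : ∀ α, Lb α *ᵥ (fun _ => (1 : ℝ)) = 0)
    (LE : Matrix (ClusterNode r Nv) (ClusterNode r Nv) ℝ)
    (hLE : LE.PosSemidef)
    (hLE1 : LE *ᵥ (fun _ => (1 : ℝ)) = 0)
    (x : ℝ → ClusterNode r Nv → ℝ)
    (hx : ∀ t : ℝ, HasDerivAt x (-((Matrix.blockDiagonal' Lb + LE) *ᵥ x t)) t) :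
    ∀ t : ℝ, HasDerivAt (fun s => slowVar r Nv (x s))
      (-(clusterPinv r Nv *ᵥ ((clusterU r Nv)ᵀ *ᵥ
            (LE *ᵥ (clusterU r Nv *ᵥ slowVar r Nv (x t)))))
        - clusterPinv r Nv *ᵥ ((clusterU r Nv)ᵀ *ᵥ (LE *ᵥ fastVar r Nv (x t)))) t := by
  have hUI : (clusterU r Nv)ᵀ * Matrix.blockDiagonal' Lb = 0 :=
    clusterU_transpose_mul_blockDiagonal' r Nv Lb fun α => by
      have hT : (Lb α)ᵀ = Lb α := by simpa using (hLb α).isHermitian.eq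
      rw [← hT, Matrix.vecMul_transpose, hLb1 α]
  intro t
  have hd := ((Matrix.mulVecLin
    (clusterPinv r Nv * (clusterU r Nv)ᵀ)).toContinuousLinearMap.hasFDerivAt).comp_hasDerivAt
      t (hx t)
  have hf : (fun s => slowVar r Nv (x s)) =
      (Matrix.mulVecLin
        (clusterPinv r Nv * (clusterU r Nv)ᵀ)).toContinuousLinearMap ∘ x := by
    funext s
    exact Matrix.mulVec_mulVec _ _ _
  have hv : -(clusterPinv r Nv *ᵥ ((clusterU r Nv)ᵀ *ᵥ
            (LE *ᵥ (clusterU r Nv *ᵥ slowVar r Nv (x t)))))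
        - clusterPinv r Nv *ᵥ ((clusterU r Nv)ᵀ *ᵥ (LE *ᵥ fastVar r Nv (x t))) =
      (Matrix.mulVecLin (clusterPinv r Nv * (clusterU r Nv)ᵀ)).toContinuousLinearMap
        (-((Matrix.blockDiagonal' Lb + LE) *ᵥ x t)) := by
    simp only [slowVar, fastVar, clusterW_eq_one_sub, LinearMap.coe_toContinuousLinearMap',
      Matrix.mulVecLin_apply, Matrix.mulVec_mulVec, Matrix.mulVec_neg]
    rw [Matrix.mul_assoc (clusterPinv r Nv) _ (_ + _), Matrix.mul_add, hUI, zero_add,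
      ← neg_add', ← Matrix.add_mulVec]
    congr 2
    simp only [Matrix.mul_sub, Matrix.mul_one]
    abel
  rw [hf, hv]
  exact hd
end
end

section
/- Let e_y ∈ ℝ^r satisfy W_r e_y = e_y and let e_x ∈ ℝ^N be arbitrary. Assume Lᴱ is symmetric positive semidefinite and that P commutes with UᵀLᴱU. Then the derivative of the Lyapunov function V_{e_y} = ½‖e_y‖² along the inter-area dynamics satisfies the bound e_yᵀ(−W_r P⁻¹UᵀLᴱU e_y − W_r P⁻¹UᵀLᴱ e_x) ≤ −½ e_yᵀ P⁻¹UᵀLᴱU e_y + (1/(2 N_min)) e_xᵀ Lᴱ e_x. -/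
open Matrix

noncomputable section

/-- Entries of a matrix commuting with a diagonal matrix may be nonzero only where the
diagonal values agree, so functions of the diagonal can be moved across. -/
theorem Matrix.apply_mul_of_diagonal_commute {n : Type*} [Fintype n] [DecidableEq n]
    {Q : Matrix n n ℝ} {d : n → ℝ} (h : diagonal d * Q = Q * diagonal d) (w : ℝ → ℝ) (i j : n) :
    w (d i) * Q i j = w (d j) * Q i j := by
  have hij := congrFun (congrFun h i) j
  rw [diagonal_mul, mul_diagonal] at hij
  have h0 : (d i - d j) * Q i j = 0 := by linear_combination hij
  rcases mul_eq_zero.mp h0 with h1 | h1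
  · rw [sub_eq_zero.mp h1]
  · simp [h1]

/-- If `Q` is positive semidefinite and commutes with `diagonal d`, then so is, as a quadratic
form, `diagonal (w ∘ d) * Q` for every `w` nonnegative on the values of `d`. -/
theorem Matrix.PosSemidef.dotProduct_diagonal_mulVec_nonneg {n : Type*} [Fintype n]
    [DecidableEq n] {Q : Matrix n n ℝ} (hQ : Q.PosSemidef) {d : n → ℝ}
    (h : diagonal d * Q = Q * diagonal d) (w : ℝ → ℝ) (hw : ∀ i, 0 ≤ w (d i)) (x : n → ℝ) :
    0 ≤ x ⬝ᵥ (diagonal (fun i => w (d i)) *ᵥ (Q *ᵥ x)) := by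
  have key := hQ.dotProduct_mulVec_nonneg (fun i => √(w (d i)) * x i)
  refine key.trans_eq ?_
  symm
  simp only [dotProduct, mulVec_diagonal]
  simp only [dotProduct, mulVec, Finset.mul_sum, Pi.star_apply, star_trivial]
  refine Finset.sum_congr rfl fun i _ => Finset.sum_congr rfl fun j _ => ?_
  have h1 := apply_mul_of_diagonal_commute h (fun t => √(w t)) i j
  have h2 := Real.mul_self_sqrt (hw i)
  linear_combination (-(x i * Q i j * x j)) * h2 + (√(w (d i)) * x i * x j) * h1

/-- Weighted Young inequality for the bilinear form of a positive semidefinite matrix. -/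
theorem Matrix.PosSemidef.neg_dotProduct_mulVec_le {n : Type*} [Fintype n]
    {L : Matrix n n ℝ} (hL : L.PosSemidef) {c : ℝ} (hc : 0 < c) (z x : n → ℝ) :
    -(z ⬝ᵥ (L *ᵥ x)) ≤ c / 2 * (z ⬝ᵥ (L *ᵥ z)) + 1 / (2 * c) * (x ⬝ᵥ (L *ᵥ x)) := by
  have hsymm : x ⬝ᵥ (L *ᵥ z) = z ⬝ᵥ (L *ᵥ x) := by
    have hT : Lᵀ = L := by simpa using hL.isHermitian.eq
    rw [dotProduct_mulVec, ← mulVec_transpose, hT, dotProduct_comm]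
  have h := hL.dotProduct_mulVec_nonneg (c • z + x)
  simp only [star_trivial, mulVec_add, mulVec_smul, dotProduct_add, add_dotProduct,
    smul_dotProduct, dotProduct_smul, smul_eq_mul, hsymm] at h
  have e : c / 2 * (z ⬝ᵥ (L *ᵥ z)) + 1 / (2 * c) * (x ⬝ᵥ (L *ᵥ x)) + z ⬝ᵥ (L *ᵥ x)
      = 1 / (2 * c) * (c * (c * (z ⬝ᵥ (L *ᵥ z)) + z ⬝ᵥ (L *ᵥ x))
        + (c * (z ⬝ᵥ (L *ᵥ x)) + x ⬝ᵥ (L *ᵥ x))) := by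
    field_simp
    ring
  have h' : 0 ≤ 1 / (2 * c) * (c * (c * (z ⬝ᵥ (L *ᵥ z)) + z ⬝ᵥ (L *ᵥ x))
        + (c * (z ⬝ᵥ (L *ᵥ x)) + x ⬝ᵥ (L *ᵥ x))) := by
    refine mul_nonneg (by positivity) ?_
    linarith
  linarith

theorem centering_transpose (n : ℕ) : (centering n)ᵀ = centering n := by
  ext i j
  simp [centering, Matrix.one_apply, eq_comm]

theorem dotProduct_centering_mulVec {n : ℕ} {e : Fin n → ℝ} (he : centering n *ᵥ e = e)
    (v : Fin n → ℝ) : e ⬝ᵥ (centering n *ᵥ v) = e ⬝ᵥ v := by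
  rw [dotProduct_mulVec, ← mulVec_transpose, centering_transpose, he]

/-- Lemma 3: the derivative of `V_{e_y} = ½‖e_y‖²` along the inter-area dynamics
satisfies `⟨e_y, ė_y⟩ ≤ −½ e_yᵀP⁻¹UᵀLᴱU e_y + (1/(2N_min)) e_xᵀLᴱe_x`. -/
theorem lyapunov_interArea_bound
    (r : ℕ) (Nv : Fin r → ℕ) (hNv : ∀ α, 0 < Nv α)
    (LE : Matrix (ClusterNode r Nv) (ClusterNode r Nv) ℝ)
    (hLE : LE.PosSemidef)
    (hcomm : clusterP r Nv * ((clusterU r Nv)ᵀ * LE * clusterU r Nv) =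
      ((clusterU r Nv)ᵀ * LE * clusterU r Nv) * clusterP r Nv)
    (Nmin : ℕ) (hNmin : IsLeast (Set.range Nv) Nmin)
    (ey : Fin r → ℝ) (hey : centering r *ᵥ ey = ey)
    (ex : ClusterNode r Nv → ℝ) :
    ey ⬝ᵥ (-(centering r *ᵥ (clusterPinv r Nv *ᵥ ((clusterU r Nv)ᵀ *ᵥ
            (LE *ᵥ (clusterU r Nv *ᵥ ey)))))
        - centering r *ᵥ (clusterPinv r Nv *ᵥ ((clusterU r Nv)ᵀ *ᵥ (LE *ᵥ ex))))
      ≤ -(1 / 2) * (ey ⬝ᵥ (clusterPinv r Nv *ᵥ ((clusterU r Nv)ᵀ *ᵥ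
            (LE *ᵥ (clusterU r Nv *ᵥ ey)))))
        + (1 / (2 * (Nmin : ℝ))) * (ex ⬝ᵥ (LE *ᵥ ex)) := by
  set U := clusterU r Nv
  set Q := Uᵀ * LE * U with hQdef
  have hQ : Q.PosSemidef := by
    simpa [hQdef] using hLE.conjTranspose_mul_mul_same U
  have hmin : 0 < (Nmin : ℝ) := by
    obtain ⟨α, hα⟩ := hNmin.1
    exact_mod_cast hα ▸ hNv α
  set z := U *ᵥ (clusterPinv r Nv *ᵥ ey) with hz
  have hcross : ∀ v, ey ⬝ᵥ (clusterPinv r Nv *ᵥ (Uᵀ *ᵥ v)) = z ⬝ᵥ v := fun v => by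
    rw [dotProduct_mulVec, dotProduct_mulVec, vecMul_transpose, ← mulVec_transpose, hz,
      clusterPinv, diagonal_transpose]
  have hquad : Nmin * (z ⬝ᵥ (LE *ᵥ z)) ≤
      ey ⬝ᵥ (clusterPinv r Nv *ᵥ (Uᵀ *ᵥ (LE *ᵥ (U *ᵥ ey)))) := by
    have h := hQ.dotProduct_diagonal_mulVec_nonneg hcomm
      (fun t => t⁻¹ - Nmin * (t⁻¹ * t⁻¹)) (fun α => by
        have hα : (0 : ℝ) < Nv α := by exact_mod_cast hNv α
        have hle : (Nmin : ℝ) ≤ Nv α := by exact_mod_cast hNmin.2 ⟨α, rfl⟩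
        have : (Nv α : ℝ)⁻¹ - Nmin * ((Nv α : ℝ)⁻¹ * (Nv α : ℝ)⁻¹)
            = (Nv α - Nmin) * ((Nv α : ℝ)⁻¹ * (Nv α : ℝ)⁻¹) := by
          field_simp
        simp only [this]
        exact mul_nonneg (sub_nonneg.mpr hle) (by positivity)) ey
    rw [← hcross, ← sub_nonneg]
    convert h using 1
    have hassoc : ∀ v, Uᵀ *ᵥ (LE *ᵥ (U *ᵥ v)) = Q *ᵥ v := fun v => by
      simp [hQdef, mulVec_mulVec, Matrix.mul_assoc]
    rw [hz, hassoc, hassoc]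
    have hP : ∀ v, clusterPinv r Nv *ᵥ v = fun α => (Nv α : ℝ)⁻¹ * v α := fun v => by
      ext α
      rw [clusterPinv, mulVec_diagonal]
    simp only [hP, dotProduct, mulVec_diagonal]
    simp only [dotProduct, mulVec, Finset.mul_sum, ← Finset.sum_sub_distrib]
    refine Finset.sum_congr rfl fun i _ => Finset.sum_congr rfl fun j _ => ?_
    have h1 := apply_mul_of_diagonal_commute hcomm (fun t => t⁻¹) i j
    linear_combination (Nmin * (Nv i : ℝ)⁻¹ * ey i * ey j) * h1
  have hyoung := hLE.neg_dotProduct_mulVec_le hmin z ex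
  rw [dotProduct_sub, dotProduct_neg, dotProduct_centering_mulVec hey,
    dotProduct_centering_mulVec hey, hcross (LE *ᵥ ex)]
  linarith
end
end
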